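/- arXiv:1808.08742 — 7 statements merged into one kernel-verified Lean document; each statement's English description precedes it below -/
import Mathlib

section
/- Let a_j, b_j, q_j : I → ℝ (j = 1,…,N) be differentiable functions on an interval I solving the Popowicz N-peakon ODE system. Then the Hamiltonian h(t) = 2∑_{j=1}^N (a_j(t) + b_j(t)) is constant on I. -/
open Finset

/-- The Popowicz `N`-peakon ODE system on a set `I ⊆ ℝ`: for each `j < N` and `t ∈ I`,
`aⱼ' = 2aⱼ ∑_{k<N} (2aₖ+bₖ) sgn(qⱼ-qₖ) e^{-|qⱼ-qₖ|}`,
`bⱼ' = bⱼ ∑_{k<N} (2aₖ+bₖ) sgn(qⱼ-qₖ) e^{-|qⱼ-qₖ|}`,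
`qⱼ' = ∑_{k<N} (2aₖ+bₖ) e^{-|qⱼ-qₖ|}`. -/
def PopowiczPeakonSystem (N : ℕ) (a b q : ℕ → ℝ → ℝ) (I : Set ℝ) : Prop :=
  ∀ j < N, ∀ t ∈ I,
    HasDerivAt (a j) (2 * a j t * ∑ k ∈ Finset.range N,
      (2 * a k t + b k t) * Real.sign (q j t - q k t) * Real.exp (-|q j t - q k t|)) t ∧
    HasDerivAt (b j) (b j t * ∑ k ∈ Finset.range N,
      (2 * a k t + b k t) * Real.sign (q j t - q k t) * Real.exp (-|q j t - q k t|)) t ∧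
    HasDerivAt (q j) (∑ k ∈ Finset.range N,
      (2 * a k t + b k t) * Real.exp (-|q j t - q k t|)) t

/-- A double sum of an antisymmetric real function over a finite set vanishes. -/
theorem sum_sum_eq_zero_of_antisymm {ι : Type*} (s : Finset ι) (F : ι → ι → ℝ)
    (hF : ∀ j k, F j k = -F k j) : ∑ j ∈ s, ∑ k ∈ s, F j k = 0 := by
  have h : ∑ j ∈ s, ∑ k ∈ s, F j k = -∑ j ∈ s, ∑ k ∈ s, F j k := by
    conv_lhs => rw [Finset.sum_comm]
    simp only [← Finset.sum_neg_distrib]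
    exact Finset.sum_congr rfl fun j _ => Finset.sum_congr rfl fun k _ => hF k j
  linarith

/-- The sum `∑ (aⱼ + bⱼ)` has zero derivative along solutions of the Popowicz system. -/
theorem PopowiczPeakonSystem.hasDerivAt_sum {N : ℕ} {a b q : ℕ → ℝ → ℝ} {I : Set ℝ}
    (hsys : PopowiczPeakonSystem N a b q I) {t : ℝ} (ht : t ∈ I) :
    HasDerivAt (fun t => ∑ j ∈ Finset.range N, (a j t + b j t)) 0 t := by
  have h := HasDerivAt.fun_sum fun j (hj : j ∈ Finset.range N) =>
    (hsys j (Finset.mem_range.mp hj) t ht).1.fun_add (hsys j (Finset.mem_range.mp hj) t ht).2.1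
  refine h.congr_deriv ?_
  simp only [Finset.mul_sum, ← Finset.sum_add_distrib]
  refine sum_sum_eq_zero_of_antisymm _ _ fun j k => ?_
  rw [← neg_sub (q k t) (q j t), Real.sign_neg, abs_neg]
  ring

/-- Along solutions of the Popowicz `N`-peakon ODE system on an interval `I`,
the Hamiltonian `h = 2 ∑_{j<N} (aⱼ + bⱼ)` is constant. -/
theorem popowicz_hamiltonian_conserved (N : ℕ) (a b q : ℕ → ℝ → ℝ)
    (I : Set ℝ) (hI : I.OrdConnected)
    (hsys : PopowiczPeakonSystem N a b q I) :
    ∀ s ∈ I, ∀ t ∈ I,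
      2 * ∑ j ∈ Finset.range N, (a j s + b j s)
        = 2 * ∑ j ∈ Finset.range N, (a j t + b j t) := by
  intro s hs t ht
  have h := hI.convex.norm_image_sub_le_of_norm_hasDerivWithin_le (C := 0)
    (fun x hx => (hsys.hasDerivAt_sum hx).hasDerivWithinAt) (by simp) ht hs
  rw [zero_mul, norm_le_zero_iff, sub_eq_zero] at h
  rw [h]
end

section
/- Let a_j, b_j, q_j : I → ℝ (j = 1,…,N) be differentiable functions on an interval I solving the Popowicz N-peakon ODE system, and suppose b_j(t) ≠ 0 for all t ∈ I. Then for each j the Casimir C_j(t) = a_j(t)/b_j(t)^2 is constant on I. -/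
open Finset

/-- If `f' = 2 f c` and `g' = g c` at a point where `g ≠ 0`, then `f / g ^ 2` has derivative zero
there. -/
lemma hasDerivAt_div_sq_eq_zero {f g : ℝ → ℝ} {c x : ℝ} (hf : HasDerivAt f (2 * f x * c) x)
    (hg : HasDerivAt g (g x * c) x) (hx : g x ≠ 0) :
    HasDerivAt (fun y => f y / g y ^ 2) 0 x := by
  refine (hf.fun_div (hg.fun_pow 2) (pow_ne_zero 2 hx)).congr_deriv ?_
  rw [div_eq_zero_iff]
  left
  push_cast
  ring

/-- Along solutions of the Popowicz `N`-peakon ODE system on an interval `I` with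
`bⱼ ≠ 0` on `I`, each Casimir `Cⱼ = aⱼ / bⱼ²` is constant. -/
theorem popowicz_casimirs_conserved (N : ℕ) (a b q : ℕ → ℝ → ℝ)
    (I : Set ℝ) (hI : I.OrdConnected)
    (hsys : PopowiczPeakonSystem N a b q I)
    (hb : ∀ j < N, ∀ t ∈ I, b j t ≠ 0) :
    ∀ j < N, ∀ s ∈ I, ∀ t ∈ I,
      a j s / (b j s) ^ 2 = a j t / (b j t) ^ 2 := by
  intro j hj s hs t ht
  have hderiv : ∀ x ∈ I,
      HasDerivWithinAt (fun y => a j y / b j y ^ 2) 0 I x := fun x hx =>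
    (hasDerivAt_div_sq_eq_zero (hsys j hj x hx).1 (hsys j hj x hx).2.1
      (hb j hj x hx)).hasDerivWithinAt
  have hle := hI.convex.norm_image_sub_le_of_norm_hasDerivWithin_le (C := 0) hderiv
    (fun _ _ => norm_zero.le) ht hs
  rw [zero_mul, norm_le_zero_iff, sub_eq_zero] at hle
  exact hle
end

section
/- Let a_j, b_j, q_j : I → ℝ (j = 1,…,N) be differentiable functions on an interval I solving the Popowicz N-peakon ODE system, and suppose the peaks are strictly ordered for all t ∈ I: q_1(t) < q_2(t) < ⋯ < q_N(t). Then the quantity J(t) = (∏_{j=1}^N b_j(t)) · ∏_{k=1}^{N-1} (1 - e^{-(q_{k+1}(t) - q_k(t))}) is constant on I. -/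
open Finset

/-- If each `f i` has logarithmic derivative `c i`, then `∏ f i` has logarithmic derivative
`∑ c i`. -/
theorem HasDerivAt.finset_prod_of_mul {ι : Type*} (s : Finset ι) {f : ι → ℝ → ℝ} {c : ι → ℝ}
    {t : ℝ} (h : ∀ i ∈ s, HasDerivAt (f i) (f i t * c i) t) :
    HasDerivAt (fun x => ∏ i ∈ s, f i x) ((∏ i ∈ s, f i t) * ∑ i ∈ s, c i) t := by
  classical
  induction s using Finset.induction_on with
  | empty => simpa using hasDerivAt_const t (1 : ℝ)
  | insert i s hi ih =>
    simp only [Finset.prod_insert hi, Finset.sum_insert hi]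
    have h1 := h i (Finset.mem_insert_self i s)
    have h2 := ih fun k hk => h k (Finset.mem_insert_of_mem hk)
    exact (h1.mul h2).congr_deriv (by ring)

/-- A sum over `range (M + 1)` whose `i`-th term vanishes, with that term skipped. -/
theorem Finset.sum_range_succ_of_eq_zero {M i : ℕ} (hi : i ≤ M) {g : ℕ → ℝ} (hg : g i = 0) :
    ∑ j ∈ Finset.range (M + 1), g j
      = ∑ k ∈ Finset.range M, if k < i then g k else g (k + 1) := by
  induction M with
  | zero =>
    obtain rfl : i = 0 := by omega
    simpa using hg
  | succ M ih =>
    rcases Nat.lt_or_ge M i with h | h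
    · obtain rfl : i = M + 1 := by omega
      rw [Finset.sum_range_succ, hg, add_zero]
      exact Finset.sum_congr rfl fun k hk => by rw [if_pos (Finset.mem_range.1 hk)]
    · rw [Finset.sum_range_succ, ih h, Finset.sum_range_succ _ M, if_neg (by omega)]

/-- For an ordered configuration, the relative velocity induced on two neighbouring peaks
`k`, `k + 1` by the peak `i`. -/
theorem exp_neg_gap_mul_sub {N : ℕ} {x : ℕ → ℝ} (hx : ∀ j k, j < k → k < N → x j < x k)
    {k i : ℕ} (hk : k + 1 < N) (hi : i < N) :
    Real.exp (-(x (k + 1) - x k))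
        * (Real.exp (-|x (k + 1) - x i|) - Real.exp (-|x k - x i|))
      = (1 - Real.exp (-(x (k + 1) - x k)))
        * -(if k < i then Real.sign (x k - x i) * Real.exp (-|x k - x i|)
          else Real.sign (x (k + 1) - x i) * Real.exp (-|x (k + 1) - x i|)) := by
  split_ifs with h
  · have h1 : x k < x i := hx k i h hi
    have h2 : x (k + 1) ≤ x i := by
      rcases Nat.lt_or_ge (k + 1) i with h' | h'
      · exact (hx _ _ h' hi).le
      · rw [show i = k + 1 by omega]
    rw [Real.sign_of_neg (sub_neg.2 h1), abs_of_neg (sub_neg.2 h1),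
      abs_of_nonpos (sub_nonpos.2 h2),
      show -(-(x k - x i)) = -(x (k + 1) - x k) + -(-(x (k + 1) - x i)) by ring, Real.exp_add]
    ring
  · have h1 : x i < x (k + 1) := hx i (k + 1) (by omega) hk
    have h2 : x i ≤ x k := by
      rcases Nat.lt_or_ge i k with h' | h'
      · exact (hx _ _ h' (by omega)).le
      · rw [show i = k by omega]
    rw [Real.sign_of_pos (sub_pos.2 h1), abs_of_pos (sub_pos.2 h1),
      abs_of_nonneg (sub_nonneg.2 h2),
      show -(x (k + 1) - x i) = -(x (k + 1) - x k) + -(x k - x i) by ring, Real.exp_add]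
    ring

/-- The logarithmic derivatives of the factors `bⱼ` and `1 - e^{-(q_{k+1} - q_k)}` cancel. -/
theorem sum_sign_add_sum_gap_eq_zero (N : ℕ) (m x : ℕ → ℝ) :
    (∑ j ∈ Finset.range N, ∑ i ∈ Finset.range N,
        m i * Real.sign (x j - x i) * Real.exp (-|x j - x i|))
      + ∑ k ∈ Finset.range (N - 1), ∑ i ∈ Finset.range N,
        m i * -(if k < i then Real.sign (x k - x i) * Real.exp (-|x k - x i|)
          else Real.sign (x (k + 1) - x i) * Real.exp (-|x (k + 1) - x i|)) = 0 := by
  rcases N with _ | M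
  · simp
  rw [Finset.sum_comm, Finset.sum_comm (s := Finset.range (M + 1 - 1)),
    ← Finset.sum_add_distrib]
  refine Finset.sum_eq_zero fun i hi => ?_
  simp only [mul_assoc]
  rw [← Finset.mul_sum, ← Finset.mul_sum, Finset.sum_neg_distrib,
    Finset.sum_range_succ_of_eq_zero (i := i) (Nat.lt_succ_iff.1 (Finset.mem_range.1 hi))
      (by simp), Nat.add_sub_cancel]
  ring

/-- Along solutions of the Popowicz `N`-peakon ODE system on an interval `I`, with
the peaks strictly ordered `q₀ < q₁ < ⋯ < q_{N-1}` throughout `I`, the quantity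
`J = (∏_{j<N} bⱼ) ∏_{k<N-1} (1 - e^{-(q_{k+1} - q_k)})` is constant. -/
theorem popowicz_J_conserved (N : ℕ) (a b q : ℕ → ℝ → ℝ)
    (I : Set ℝ) (hI : I.OrdConnected)
    (hsys : PopowiczPeakonSystem N a b q I)
    (horder : ∀ t ∈ I, ∀ j k, j < k → k < N → q j t < q k t) :
    ∀ s ∈ I, ∀ t ∈ I,
      (∏ j ∈ Finset.range N, b j s)
          * ∏ k ∈ Finset.range (N - 1), (1 - Real.exp (-(q (k + 1) s - q k s)))
        = (∏ j ∈ Finset.range N, b j t)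
          * ∏ k ∈ Finset.range (N - 1), (1 - Real.exp (-(q (k + 1) t - q k t))) := by
  have hderiv : ∀ t ∈ I, HasDerivAt (fun t => (∏ j ∈ Finset.range N, b j t)
      * ∏ k ∈ Finset.range (N - 1), (1 - Real.exp (-(q (k + 1) t - q k t)))) 0 t := by
    intro t ht
    have hb := HasDerivAt.finset_prod_of_mul (Finset.range N)
      fun j hj => (hsys j (Finset.mem_range.1 hj) t ht).2.1
    have hgap := HasDerivAt.finset_prod_of_mul (t := t) (Finset.range (N - 1))
      (f := fun k t => 1 - Real.exp (-(q (k + 1) t - q k t)))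
      (c := fun k => ∑ i ∈ Finset.range N, (2 * a i t + b i t)
        * -(if k < i then Real.sign (q k t - q i t) * Real.exp (-|q k t - q i t|)
          else Real.sign (q (k + 1) t - q i t) * Real.exp (-|q (k + 1) t - q i t|)))
      (fun k hk => by
        have hkN : k + 1 < N := by have := Finset.mem_range.1 hk; omega
        have hq := (hsys (k + 1) hkN t ht).2.2.sub (hsys k (by omega) t ht).2.2
        refine (hq.neg.exp.const_sub 1).congr_deriv ?_
        simp only [Pi.neg_apply, Pi.sub_apply]
        rw [← Finset.sum_sub_distrib, mul_neg, neg_neg, Finset.mul_sum, Finset.mul_sum]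
        refine Finset.sum_congr rfl fun i hi => ?_
        linear_combination (2 * a i t + b i t)
          * exp_neg_gap_mul_sub (horder t ht) hkN (Finset.mem_range.1 hi))
    refine (hb.mul hgap).congr_deriv ?_
    linear_combination ((∏ j ∈ Finset.range N, b j t)
        * ∏ k ∈ Finset.range (N - 1), (1 - Real.exp (-(q (k + 1) t - q k t))))
      * sum_sign_add_sum_gap_eq_zero N (fun i => 2 * a i t + b i t) (fun i => q i t)
  intro s hs t ht
  have h := hI.convex.norm_image_sub_le_of_norm_hasDerivWithin_le (C := 0)
    (fun x hx => (hderiv x hx).hasDerivWithinAt) (fun _ _ => by simp) ht hs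
  rw [zero_mul] at h
  exact sub_eq_zero.1 (norm_le_zero_iff.1 h)
end

section
/- Let q_1 < q_2 < ⋯ < q_N be real numbers and set E_{jk} = e^{-|q_j - q_k|}. Then for every k ∈ {1,…,N}, S_k := -∑_{j=1}^{k-1} E_{jk} + ∑_{j=k+1}^{N} E_{jk} - ∑_{ℓ=1}^{N-1} (E_{ℓ,k} - E_{ℓ+1,k}) E_{ℓ,ℓ+1} / (1 - E_{ℓ,ℓ+1}) = 0. -/
open Finset

/-- For strictly ordered peak positions `q₀ < q₁ < ⋯ < q_{N-1}` and
`E_{jk} = e^{-|qⱼ - qₖ|}`, the quantity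
`S_k = -∑_{j<k} E_{jk} + ∑_{k<j<N} E_{jk} - ∑_{ℓ<N-1} (E_{ℓ,k} - E_{ℓ+1,k}) E_{ℓ,ℓ+1}/(1 - E_{ℓ,ℓ+1})`
vanishes for every `k < N`. -/
theorem popowicz_Sk_vanishes (N : ℕ) (q : ℕ → ℝ)
    (hq : ∀ j k, j < k → k < N → q j < q k)
    (E : ℕ → ℕ → ℝ) (hE : ∀ j k, E j k = Real.exp (-|q j - q k|))
    (k : ℕ) (hk : k < N) :
    -(∑ j ∈ Finset.range k, E j k)
      + (∑ j ∈ Finset.Ico (k + 1) N, E j k)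
      - (∑ l ∈ Finset.range (N - 1),
          (E l k - E (l + 1) k) * E l (l + 1) / (1 - E l (l + 1))) = 0 := by
  have mul_step : ∀ a b c, q a ≤ q b → q b ≤ q c → E a c = E a b * E b c := by
    intro a b c hab hbc
    rw [hE, hE, hE, ← Real.exp_add, abs_of_nonpos (by linarith), abs_of_nonpos (by linarith),
      abs_of_nonpos (by linarith)]
    ring_nf
  have E_comm : ∀ a b, E a b = E b a := by
    intro a b
    rw [hE, hE, abs_sub_comm]
  have one_sub_ne : ∀ l, l + 1 < N → 1 - E l (l + 1) ≠ 0 := by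
    intro l hl
    have h : E l (l + 1) < 1 := by
      rw [hE, Real.exp_lt_one_iff, neg_lt_zero, abs_pos, sub_ne_zero]
      exact (hq l (l + 1) l.lt_succ_self hl).ne
    linarith
  have q_le : ∀ a b, a ≤ b → b < N → q a ≤ q b := by
    intro a b hab hb
    rcases hab.eq_or_lt with rfl | h
    · exact le_rfl
    · exact (hq a b h hb).le
  have sum_left : ∑ l ∈ Finset.range k,
      (E l k - E (l + 1) k) * E l (l + 1) / (1 - E l (l + 1)) = -∑ j ∈ Finset.range k, E j k := by
    rw [← Finset.sum_neg_distrib]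
    refine Finset.sum_congr rfl fun l hl => ?_
    have hlk := Finset.mem_range.mp hl
    rw [div_eq_iff (one_sub_ne l (by omega)),
      mul_step l (l + 1) k (q_le _ _ (by omega) (by omega)) (q_le _ _ (by omega) hk)]
    ring
  have sum_right : ∑ l ∈ Finset.Ico k (N - 1),
      (E l k - E (l + 1) k) * E l (l + 1) / (1 - E l (l + 1)) =
        ∑ j ∈ Finset.Ico (k + 1) N, E j k := by
    obtain ⟨M, rfl⟩ : ∃ M, N = M + 1 := ⟨N - 1, by omega⟩
    rw [Nat.add_sub_cancel, ← Finset.sum_Ico_add' (fun j => E j k) k M 1]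
    refine Finset.sum_congr rfl fun l hl => ?_
    have hlM := Finset.mem_Ico.mp hl
    rw [div_eq_iff (one_sub_ne l (by omega)), E_comm (l + 1) k, E_comm l k,
      mul_step k l (l + 1) (q_le _ _ (by omega) (by omega)) (q_le _ _ (by omega) (by omega))]
    ring
  rw [← Finset.sum_range_add_sum_Ico _ (show k ≤ N - 1 by omega), sum_left, sum_right]
  ring
end

section
/- Let k_1, k_2 > 0 and let b_1, b_2, q_1, q_2 : ℝ → ℝ be differentiable functions solving the reduced Popowicz 2-peakon system b_1' = b_1 b_2 (2k_2^2 b_2 + 1) sgn(q_1 - q_2) e^{-|q_1 - q_2|}, b_2' = b_1 b_2 (2k_1^2 b_1 + 1) sgn(q_2 - q_1) e^{-|q_1 - q_2|}, q_1' = b_1(2k_1^2 b_1 + 1) + b_2(2k_2^2 b_2 + 1) e^{-|q_1 - q_2|}, q_2' = b_2(2k_2^2 b_2 + 1) + b_1(2k_1^2 b_1 + 1) e^{-|q_1 - q_2|}, with initial data b_1(0) > 0, b_2(0) > 0 and q_1(0) < q_2(0). Then for all t ∈ ℝ: b_1(t) > 0, b_2(t) > 0, q_1(t) < q_2(t), and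 b_1(t) b_2(t) > J, where J = b_1(0) b_2(0) (1 - e^{q_1(0) - q_2(0)}) > 0. -/
/-- A differentiable function with `|f'| ≤ M |f|`, `M` continuous, that vanishes at `a`
vanishes on `[a, ∞)`. -/
theorem eq_zero_of_abs_deriv_le_mul_abs_of_le {f f' M : ℝ → ℝ} (hM : Continuous M)
    (hf : ∀ t, HasDerivAt f (f' t) t) (hbound : ∀ t, |f' t| ≤ M t * |f t|)
    {a t : ℝ} (hat : a ≤ t) (ha : f a = 0) : f t = 0 := by
  obtain ⟨K, hK⟩ := (isCompact_Icc (a := a) (b := t)).bddAbove_image hM.continuousOn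
  exact eq_zero_of_abs_deriv_le_mul_abs_self_of_eq_zero_right (K := K)
    (fun x _ => (hf x).continuousAt.continuousWithinAt) (fun x _ => (hf x).hasDerivWithinAt) ha
    (fun x hx => (hbound x).trans (mul_le_mul_of_nonneg_right
      (hK (Set.mem_image_of_mem M (Set.Ico_subset_Icc_self hx))) (abs_nonneg _)))
    t (Set.right_mem_Icc.2 hat)

/-- A differentiable function with `|f'| ≤ M |f|`, `M` continuous, that vanishes somewhere
vanishes everywhere. -/
theorem eq_zero_of_abs_deriv_le_mul_abs {f f' M : ℝ → ℝ} (hM : Continuous M)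
    (hf : ∀ t, HasDerivAt f (f' t) t) (hbound : ∀ t, |f' t| ≤ M t * |f t|)
    {a : ℝ} (ha : f a = 0) (t : ℝ) : f t = 0 := by
  rcases le_total a t with hat | hta
  · exact eq_zero_of_abs_deriv_le_mul_abs_of_le hM hf hbound hat ha
  · have h := eq_zero_of_abs_deriv_le_mul_abs_of_le (f := fun s => f (-s))
      (f' := fun s => -f' (-s)) (M := fun s => M (-s)) (hM.comp continuous_neg)
      (fun s => by
        simpa [Function.comp_def] using (hf (-s)).comp s (hasDerivAt_neg s))
      (fun s => by simpa using hbound (-s)) (neg_le_neg hta) (by simpa using ha)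
    simpa using h

/-- A continuous function without zeros that is positive at one point is positive everywhere. -/
theorem pos_of_continuous_of_ne_zero {f : ℝ → ℝ} (hf : Continuous f) (hne : ∀ t, f t ≠ 0)
    {a : ℝ} (ha : 0 < f a) (t : ℝ) : 0 < f t := by
  by_contra! h
  obtain ⟨s, hs⟩ := mem_range_of_exists_le_of_exists_ge hf ⟨t, h⟩ ⟨a, ha.le⟩
  exact hne s hs

/-- For solutions of the reduced Popowicz 2-peakon system with positive initial
amplitudes `b₁(0), b₂(0) > 0` and ordering `q₁(0) < q₂(0)`, the amplitudes stay
positive for all time, the peakons never overlap (`q₁(t) < q₂(t)` for all `t`),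
and `b₁(t) b₂(t) > J` where `J = b₁(0) b₂(0)(1 - e^{q₁(0)-q₂(0)}) > 0` is the value
of the first integral. -/
theorem popowicz_two_peakon_positivity (k₁ k₂ : ℝ) (hk₁ : 0 < k₁) (hk₂ : 0 < k₂)
    (b₁ b₂ q₁ q₂ : ℝ → ℝ)
    (hb₁ : ∀ t, HasDerivAt b₁ (b₁ t * b₂ t * (2 * k₂ ^ 2 * b₂ t + 1)
        * Real.sign (q₁ t - q₂ t) * Real.exp (-|q₁ t - q₂ t|)) t)
    (hb₂ : ∀ t, HasDerivAt b₂ (b₁ t * b₂ t * (2 * k₁ ^ 2 * b₁ t + 1)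
        * Real.sign (q₂ t - q₁ t) * Real.exp (-|q₁ t - q₂ t|)) t)
    (hq₁ : ∀ t, HasDerivAt q₁ (b₁ t * (2 * k₁ ^ 2 * b₁ t + 1)
        + b₂ t * (2 * k₂ ^ 2 * b₂ t + 1) * Real.exp (-|q₁ t - q₂ t|)) t)
    (hq₂ : ∀ t, HasDerivAt q₂ (b₂ t * (2 * k₂ ^ 2 * b₂ t + 1)
        + b₁ t * (2 * k₁ ^ 2 * b₁ t + 1) * Real.exp (-|q₁ t - q₂ t|)) t)
    (hb₁0 : 0 < b₁ 0) (hb₂0 : 0 < b₂ 0) (hq0 : q₁ 0 < q₂ 0) :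
    0 < b₁ 0 * b₂ 0 * (1 - Real.exp (q₁ 0 - q₂ 0)) ∧
    ∀ t, 0 < b₁ t ∧ 0 < b₂ t ∧ q₁ t < q₂ t ∧
      b₁ 0 * b₂ 0 * (1 - Real.exp (q₁ 0 - q₂ 0)) < b₁ t * b₂ t := by
  have hJ : 0 < b₁ 0 * b₂ 0 * (1 - Real.exp (q₁ 0 - q₂ 0)) :=
    mul_pos (mul_pos hb₁0 hb₂0) (sub_pos.2 (by simpa using hq0))
  refine ⟨hJ, ?_⟩
  have cb₁ : Continuous b₁ := continuous_iff_continuousAt.2 fun t => (hb₁ t).continuousAt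
  have cb₂ : Continuous b₂ := continuous_iff_continuousAt.2 fun t => (hb₂ t).continuousAt
  have hu : ∀ t, HasDerivAt (fun t => q₂ t - q₁ t)
      ((b₂ t * (2 * k₂ ^ 2 * b₂ t + 1) - b₁ t * (2 * k₁ ^ 2 * b₁ t + 1))
        * (1 - Real.exp (-|q₁ t - q₂ t|))) t := fun t =>
    ((hq₂ t).sub (hq₁ t)).congr_deriv (by ring)
  have hexp : ∀ t, |1 - Real.exp (-|q₁ t - q₂ t|)| ≤ |q₂ t - q₁ t| := fun t => by
    rw [abs_sub_comm (q₂ t), abs_of_nonneg]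
    · linarith [Real.add_one_le_exp (-|q₁ t - q₂ t|)]
    · simp
  have hne : ∀ t, q₂ t - q₁ t ≠ 0 := fun t ht =>
    (sub_pos.2 hq0).ne' (eq_zero_of_abs_deriv_le_mul_abs
      (M := fun t => |b₂ t * (2 * k₂ ^ 2 * b₂ t + 1) - b₁ t * (2 * k₁ ^ 2 * b₁ t + 1)|)
      (by fun_prop) hu
      (fun s => by rw [abs_mul]; exact mul_le_mul_of_nonneg_left (hexp s) (abs_nonneg _)) ht 0)
  have hq : ∀ t, q₁ t < q₂ t := fun t => sub_pos.1 <| pos_of_continuous_of_ne_zero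
    (continuous_iff_continuousAt.2 fun t => (hu t).continuousAt) hne (sub_pos.2 hq0) t
  have hJ' : ∀ t, HasDerivAt (fun t => b₁ t * b₂ t * (1 - Real.exp (q₁ t - q₂ t))) 0 t := by
    intro t
    have hneg : q₁ t - q₂ t < 0 := sub_neg.2 (hq t)
    refine (((hb₁ t).mul (hb₂ t)).mul (((hq₁ t).sub (hq₂ t)).exp.const_sub 1)).congr_deriv ?_
    simp only [Pi.mul_apply, Pi.sub_apply]
    rw [Real.sign_of_neg hneg, Real.sign_of_pos (sub_pos.2 (hq t)), abs_of_neg hneg, neg_neg]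
    ring
  have hconst : ∀ t, b₁ t * b₂ t * (1 - Real.exp (q₁ t - q₂ t))
      = b₁ 0 * b₂ 0 * (1 - Real.exp (q₁ 0 - q₂ 0)) := fun t =>
    is_const_of_deriv_eq_zero (fun s => (hJ' s).differentiableAt) (fun s => (hJ' s).deriv) t 0
  have hprod : ∀ t, b₁ t * b₂ t ≠ 0 := fun t h => by
    have := hconst t
    rw [h, zero_mul] at this
    exact hJ.ne this
  intro t
  have h₁ := pos_of_continuous_of_ne_zero cb₁ (fun s => left_ne_zero_of_mul (hprod s)) hb₁0 t
  have h₂ := pos_of_continuous_of_ne_zero cb₂ (fun s => right_ne_zero_of_mul (hprod s)) hb₂0 t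
  refine ⟨h₁, h₂, hq t, ?_⟩
  rw [← hconst t]
  exact mul_lt_of_lt_one_right (mul_pos h₁ h₂) (sub_lt_self 1 (Real.exp_pos _))
end

section
/- Let k_1, k_2 > 0 and let b_1, b_2, q_1, q_2 : [0,∞) → ℝ be differentiable functions solving the reduced Popowicz 2-peakon system with b_1(t) > 0 and b_2(t) > 0 for all t ≥ 0, and set h = 2b_1(0)(k_1^2 b_1(0) + 1) + 2b_2(0)(k_2^2 b_2(0) + 1). Then for j = 1, 2 and all t ≥ 0: b_j(0) e^{-h t} ≤ b_j(t) ≤ b_j(0) e^{h t}. -/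
/-- A function on `[0, ∞)` with `|f'| ≤ c f` grows and decays at most at the exponential rate `c`. -/
theorem exp_bounds_of_abs_deriv_le {f f' : ℝ → ℝ} {c : ℝ}
    (hf : ∀ t ∈ Set.Ici (0 : ℝ), HasDerivWithinAt f (f' t) (Set.Ici 0) t)
    (hf' : ∀ t ∈ Set.Ici (0 : ℝ), |f' t| ≤ c * f t) {t : ℝ} (ht : t ∈ Set.Ici (0 : ℝ)) :
    f 0 * Real.exp (-c * t) ≤ f t ∧ f t ≤ f 0 * Real.exp (c * t) := by
  have hd (a : ℝ) : ∀ s ∈ Set.Ici (0 : ℝ), HasDerivWithinAt (fun s => f s * Real.exp (a * s))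
      ((f' s + a * f s) * Real.exp (a * s)) (Set.Ici 0) s := by
    intro s hs
    refine ((hf s hs).mul (((hasDerivAt_id s).const_mul a).exp.hasDerivWithinAt)).congr_deriv ?_
    simp only [id_eq]
    ring
  have hmono : MonotoneOn (fun s => f s * Real.exp (c * s)) (Set.Ici 0) :=
    monotoneOn_of_hasDerivWithinAt_nonneg (convex_Ici 0)
      (fun s hs => (hd c s hs).continuousWithinAt)
      (fun s hs => (hd c s (interior_subset hs)).mono interior_subset)
      (fun s hs => mul_nonneg
        (by linarith [(abs_le.1 (hf' s (interior_subset hs))).1]) (Real.exp_pos _).le)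
  have hanti : AntitoneOn (fun s => f s * Real.exp (-c * s)) (Set.Ici 0) :=
    antitoneOn_of_hasDerivWithinAt_nonpos (convex_Ici 0)
      (fun s hs => (hd (-c) s hs).continuousWithinAt)
      (fun s hs => (hd (-c) s (interior_subset hs)).mono interior_subset)
      (fun s hs => mul_nonpos_of_nonpos_of_nonneg
        (by linarith [(abs_le.1 (hf' s (interior_subset hs))).2]) (Real.exp_pos _).le)
  have h₁ := hmono Set.self_mem_Ici ht ht
  have h₂ := hanti Set.self_mem_Ici ht ht
  simp only [mul_zero, Real.exp_zero, mul_one] at h₁ h₂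
  rw [neg_mul, Real.exp_neg] at h₂ ⊢
  exact ⟨(mul_inv_le_iff₀ (Real.exp_pos _)).2 h₁, (mul_inv_le_iff₀ (Real.exp_pos _)).1 h₂⟩

/-- A function on `[0, ∞)` with zero derivative is constant. -/
theorem eq_apply_zero_of_deriv_eq_zero {f : ℝ → ℝ}
    (hf : ∀ t ∈ Set.Ici (0 : ℝ), HasDerivWithinAt f 0 (Set.Ici 0) t)
    {t : ℝ} (ht : t ∈ Set.Ici (0 : ℝ)) : f t = f 0 := by
  refine le_antisymm ?_ ?_
  · exact antitoneOn_of_hasDerivWithinAt_nonpos (convex_Ici 0)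
      (fun s hs => (hf s hs).continuousWithinAt)
      (fun s hs => (hf s (interior_subset hs)).mono interior_subset)
      (fun _ _ => le_rfl) Set.self_mem_Ici ht ht
  · exact monotoneOn_of_hasDerivWithinAt_nonneg (convex_Ici 0)
      (fun s hs => (hf s hs).continuousWithinAt)
      (fun s hs => (hf s (interior_subset hs)).mono interior_subset)
      (fun _ _ => le_rfl) Set.self_mem_Ici ht ht

/-- The interaction term of an amplitude is bounded by its smooth factor. -/
theorem abs_mul_sign_mul_exp_neg_abs_le {a : ℝ} (ha : 0 ≤ a) (x y : ℝ) :
    |a * Real.sign x * Real.exp (-|y|)| ≤ a := by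
  have hs : |Real.sign x| ≤ 1 := by
    rcases Real.sign_apply_eq x with h | h | h <;> simp [h]
  have he : Real.exp (-|y|) ≤ 1 := Real.exp_le_one_iff.2 (neg_nonpos.2 (abs_nonneg y))
  rw [abs_mul, abs_mul, abs_of_nonneg ha, abs_of_pos (Real.exp_pos _)]
  exact mul_le_of_le_one_right (by positivity) he |>.trans (mul_le_of_le_one_right ha hs)

/-- Gronwall-type bounds for the reduced Popowicz 2-peakon system on `[0, ∞)`:
if the amplitudes `b₁, b₂` stay positive, then with
`h = 2b₁(0)(k₁²b₁(0)+1) + 2b₂(0)(k₂²b₂(0)+1)` one has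
`bⱼ(0) e^{-ht} ≤ bⱼ(t) ≤ bⱼ(0) e^{ht}` for `j = 1, 2` and all `t ≥ 0`. -/
theorem popowicz_two_peakon_gronwall (k₁ k₂ : ℝ) (hk₁ : 0 < k₁) (hk₂ : 0 < k₂)
    (b₁ b₂ q₁ q₂ : ℝ → ℝ)
    (hb₁ : ∀ t ∈ Set.Ici (0 : ℝ), HasDerivWithinAt b₁
      (b₁ t * b₂ t * (2 * k₂ ^ 2 * b₂ t + 1)
        * Real.sign (q₁ t - q₂ t) * Real.exp (-|q₁ t - q₂ t|)) (Set.Ici 0) t)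
    (hb₂ : ∀ t ∈ Set.Ici (0 : ℝ), HasDerivWithinAt b₂
      (b₁ t * b₂ t * (2 * k₁ ^ 2 * b₁ t + 1)
        * Real.sign (q₂ t - q₁ t) * Real.exp (-|q₁ t - q₂ t|)) (Set.Ici 0) t)
    (hq₁ : ∀ t ∈ Set.Ici (0 : ℝ), HasDerivWithinAt q₁
      (b₁ t * (2 * k₁ ^ 2 * b₁ t + 1)
        + b₂ t * (2 * k₂ ^ 2 * b₂ t + 1) * Real.exp (-|q₁ t - q₂ t|)) (Set.Ici 0) t)
    (hq₂ : ∀ t ∈ Set.Ici (0 : ℝ), HasDerivWithinAt q₂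
      (b₂ t * (2 * k₂ ^ 2 * b₂ t + 1)
        + b₁ t * (2 * k₁ ^ 2 * b₁ t + 1) * Real.exp (-|q₁ t - q₂ t|)) (Set.Ici 0) t)
    (hpos₁ : ∀ t ∈ Set.Ici (0 : ℝ), 0 < b₁ t)
    (hpos₂ : ∀ t ∈ Set.Ici (0 : ℝ), 0 < b₂ t)
    (h : ℝ)
    (hh : h = 2 * b₁ 0 * (k₁ ^ 2 * b₁ 0 + 1) + 2 * b₂ 0 * (k₂ ^ 2 * b₂ 0 + 1)) :
    ∀ t ∈ Set.Ici (0 : ℝ),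
      (b₁ 0 * Real.exp (-h * t) ≤ b₁ t ∧ b₁ t ≤ b₁ 0 * Real.exp (h * t)) ∧
      (b₂ 0 * Real.exp (-h * t) ≤ b₂ t ∧ b₂ t ≤ b₂ 0 * Real.exp (h * t)) := by
  have hcons : ∀ t ∈ Set.Ici (0 : ℝ),
      2 * b₁ t * (k₁ ^ 2 * b₁ t + 1) + 2 * b₂ t * (k₂ ^ 2 * b₂ t + 1) = h := by
    intro t ht
    rw [hh]
    refine eq_apply_zero_of_deriv_eq_zero
      (f := fun t => 2 * b₁ t * (k₁ ^ 2 * b₁ t + 1) + 2 * b₂ t * (k₂ ^ 2 * b₂ t + 1))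
      (fun s hs => ?_) ht
    have hd₁ := ((hb₁ s hs).const_mul 2).mul (((hb₁ s hs).const_mul (k₁ ^ 2)).add_const 1)
    have hd₂ := ((hb₂ s hs).const_mul 2).mul (((hb₂ s hs).const_mul (k₂ ^ 2)).add_const 1)
    refine (hd₁.add hd₂).congr_deriv ?_
    rw [← neg_sub (q₁ s) (q₂ s), Real.sign_neg]
    ring
  intro t ht
  refine ⟨exp_bounds_of_abs_deriv_le hb₁ (fun s hs => ?_) ht,
    exp_bounds_of_abs_deriv_le hb₂ (fun s hs => ?_) ht⟩
  · have h₁ := hpos₁ s hs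
    have h₂ := hpos₂ s hs
    refine (abs_mul_sign_mul_exp_neg_abs_le (by positivity) _ _).trans ?_
    have hle : b₂ s * (2 * k₂ ^ 2 * b₂ s + 1) ≤ h := by
      have : 0 < 2 * b₁ s * (k₁ ^ 2 * b₁ s + 1) := by positivity
      linarith [hcons s hs]
    linarith [mul_le_mul_of_nonneg_left hle h₁.le]
  · have h₁ := hpos₁ s hs
    have h₂ := hpos₂ s hs
    refine (abs_mul_sign_mul_exp_neg_abs_le (by positivity) _ _).trans ?_
    have hle : b₁ s * (2 * k₁ ^ 2 * b₁ s + 1) ≤ h := by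
      have : 0 < 2 * b₂ s * (k₂ ^ 2 * b₂ s + 1) := by positivity
      linarith [hcons s hs]
    linarith [mul_le_mul_of_nonneg_left hle h₂.le]
end

section
/- Let k_1, k_2 > 0 and h, J ∈ ℝ with J > 0. Suppose there exists a point (β_1, β_2) with β_1 > 0, β_2 > 0 satisfying 2β_1(k_1^2 β_1 + 1) + 2β_2(k_2^2 β_2 + 1) = h and β_1 β_2 > J. Then there exist at least two distinct points (b_1, b_2) ∈ ℝ^2 with b_1 > 0, b_2 > 0, 2b_1(k_1^2 b_1 + 1) + 2b_2(k_2^2 b_2 + 1) = h, and b_1 b_2 = J. (These are the intersections of the ellipse h = const with the upper branch of the hyperbola b_1 b_2 = J, which give the asymptotic amplitudes (b_1^±, b_2^±) of the two peakons.) -/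
/-- If the ellipse `2b₁(k₁²b₁+1) + 2b₂(k₂²b₂+1) = h` contains a point of the
positive quadrant lying strictly above the hyperbola `b₁b₂ = J` (with `J > 0`),
then the ellipse meets the upper branch of the hyperbola in at least two distinct
points with positive coordinates (the asymptotic amplitudes `(b₁^±, b₂^±)` of the
two peakons). -/
theorem popowicz_two_intersections (k₁ k₂ h J : ℝ)
    (hk₁ : 0 < k₁) (hk₂ : 0 < k₂) (hJ : 0 < J)
    (β₁ β₂ : ℝ) (hβ₁ : 0 < β₁) (hβ₂ : 0 < β₂)
    (hβ : 2 * β₁ * (k₁ ^ 2 * β₁ + 1) + 2 * β₂ * (k₂ ^ 2 * β₂ + 1) = h)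
    (hhyp : J < β₁ * β₂) :
    ∃ p q : ℝ × ℝ, p ≠ q ∧
      (0 < p.1 ∧ 0 < p.2 ∧
        2 * p.1 * (k₁ ^ 2 * p.1 + 1) + 2 * p.2 * (k₂ ^ 2 * p.2 + 1) = h ∧
        p.1 * p.2 = J) ∧
      (0 < q.1 ∧ 0 < q.2 ∧
        2 * q.1 * (k₁ ^ 2 * q.1 + 1) + 2 * q.2 * (k₂ ^ 2 * q.2 + 1) = h ∧
        q.1 * q.2 = J) := by
  set E : ℝ → ℝ → ℝ := fun x y => 2 * x * (k₁ ^ 2 * x + 1) + 2 * y * (k₂ ^ 2 * y + 1) with hE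
  set f : ℝ → ℝ := fun x => E x (J / x) with hf
  have hcont : ∀ a b : ℝ, 0 < a → ContinuousOn f (Set.Icc a b) := by
    intro a b ha
    have hdiv : ContinuousOn (fun x : ℝ => J / x) (Set.Icc a b) :=
      continuousOn_const.div continuousOn_id fun x hx => (ha.trans_le hx.1).ne'
    simp only [hf, hE]
    fun_prop
  have hlower : ∀ x y : ℝ, 0 < x → 0 < y → 2 * x + 2 * y < E x y := by
    intro x y hx hy
    have h₁ : 0 < k₁ ^ 2 * x ^ 2 := by positivity
    have h₂ : 0 < k₂ ^ 2 * y ^ 2 := by positivity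
    simp only [hE]
    linarith
  have hh : 0 < h := by
    rw [← hβ]
    positivity
  have hmid : f β₁ < h := by
    have hy : J / β₁ < β₂ := by
      rw [div_lt_iff₀ hβ₁]
      linarith
    have hy₀ : 0 < J / β₁ := by positivity
    rw [← hβ]
    simp only [hf, hE]
    gcongr
  have ha : 0 < J / (β₂ + h) := by positivity
  have haβ : J / (β₂ + h) < β₁ := by
    rw [div_lt_iff₀ (by positivity)]
    nlinarith
  have hleft : h < f (J / (β₂ + h)) := by
    have := hlower _ (J / (J / (β₂ + h))) ha (by positivity)
    have hinv : J / (J / (β₂ + h)) = β₂ + h := div_div_cancel₀ hJ.ne'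
    simp only [hf]
    linarith
  have hright : h < f (β₁ + h) := by
    have hc : 0 < β₁ + h := by positivity
    have hy : 0 < J / (β₁ + h) := by positivity
    have := hlower _ _ hc hy
    simp only [hf]
    linarith
  obtain ⟨x, hx, hfx⟩ := intermediate_value_Ioo' haβ.le (hcont _ _ ha) ⟨hmid, hleft⟩
  obtain ⟨z, hz, hfz⟩ :=
    intermediate_value_Ioo (by linarith : β₁ ≤ β₁ + h) (hcont _ _ hβ₁) ⟨hmid, hright⟩
  have hx₀ : 0 < x := ha.trans hx.1
  have hz₀ : 0 < z := hβ₁.trans hz.1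
  refine ⟨(x, J / x), (z, J / z), fun heq => ?_,
    ⟨hx₀, by positivity, hfx, mul_div_cancel₀ J hx₀.ne'⟩,
    ⟨hz₀, by positivity, hfz, mul_div_cancel₀ J hz₀.ne'⟩⟩
  exact (hx.2.trans hz.1).ne (congrArg Prod.fst heq)
end
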